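/- If α ∈ S_k and β ∈ S_l are permutations that both avoid the pattern 132, then the permutation α∨β ∈ S_{k+l−1} avoids the pattern 132. (This gives a direct proof that the Loday–Ronco algebra PBT is stable under the # product.) -/

import Mathlib

/-- A list of naturals is a permutation of `{1,…,n}` written as a word `σ₁ σ₂ … σ_n`. -/
def IsPermList (σ : List ℕ) : Prop := σ.Perm (List.range' 1 σ.length)

/-- The permutation `α ∨ β ∈ S_{k+l−1}` for `α ∈ S_k`, `β ∈ S_l`: the first `k` letters
are `α_i + β₁ − 1` if `α_i ≤ α_k` and `α_i + l − 1` if `α_i > α_k`, followed, for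
`2 ≤ i ≤ l`, by `β_i` if `β_i < β₁` and `β_i + α_k − 1` if `β_i ≥ β₁`. -/
def vee (α β : List ℕ) : List ℕ :=
  (α.map (fun x => if x ≤ α.getD (α.length - 1) 0 then x + β.getD 0 0 - 1
      else x + β.length - 1)) ++
    ((β.drop 1).map (fun y => if y < β.getD 0 0 then y
      else y + α.getD (α.length - 1) 0 - 1))

/-- A word avoids the pattern 132 if there are no positions `i < j < m` (0-indexed
here) such that `w_i < w_m < w_j`. -/
def Avoids132 (w : List ℕ) : Prop :=
  ∀ i j m, i < j → j < m → m < w.length →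
    ¬ (w.getD i 0 < w.getD m 0 ∧ w.getD m 0 < w.getD j 0)

theorem IsPermList.one_le_getD {σ : List ℕ} (h : IsPermList σ) {i : ℕ} (hi : i < σ.length) :
    1 ≤ σ.getD i 0 := by
  have hmem : σ[i] ∈ List.range' 1 σ.length := h.mem_iff.1 (List.getElem_mem hi)
  rw [List.mem_range'_1] at hmem
  rw [List.getD_eq_getElem _ _ hi]
  exact hmem.1

theorem IsPermList.getD_le_length {σ : List ℕ} (h : IsPermList σ) {i : ℕ} (hi : i < σ.length) :
    σ.getD i 0 ≤ σ.length := by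
  have hmem : σ[i] ∈ List.range' 1 σ.length := h.mem_iff.1 (List.getElem_mem hi)
  rw [List.mem_range'_1] at hmem
  rw [List.getD_eq_getElem _ _ hi]
  omega

theorem IsPermList.getD_inj {σ : List ℕ} (h : IsPermList σ) {i j : ℕ} (hi : i < σ.length)
    (hj : j < σ.length) (hij : σ.getD i 0 = σ.getD j 0) : i = j := by
  have hnodup : σ.Nodup := h.nodup_iff.2 List.nodup_range'
  rw [List.getD_eq_getElem _ _ hi, List.getD_eq_getElem _ _ hj] at hij
  exact (hnodup.getElem_inj_iff).1 hij

theorem vee_length (α β : List ℕ) : (vee α β).length = α.length + (β.length - 1) := by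
  simp [vee]

theorem vee_getD_left (α β : List ℕ) {i : ℕ} (hi : i < α.length) :
    (vee α β).getD i 0 =
      if α.getD i 0 ≤ α.getD (α.length - 1) 0 then α.getD i 0 + β.getD 0 0 - 1
      else α.getD i 0 + β.length - 1 := by
  unfold vee
  rw [List.getD_append _ _ _ _ (by simpa using hi), List.getD_eq_getElem _ _ (by simpa using hi),
    List.getElem_map, List.getD_eq_getElem α _ hi]

theorem vee_getD_right (α β : List ℕ) {i : ℕ} (hi : i + 1 < β.length) :
    (vee α β).getD (α.length + i) 0 =
      if β.getD (i + 1) 0 < β.getD 0 0 then β.getD (i + 1) 0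
      else β.getD (i + 1) 0 + α.getD (α.length - 1) 0 - 1 := by
  have hi' : i < β.length - 1 := by omega
  unfold vee
  rw [List.getD_append_right _ _ _ _ (by simp), List.length_map, Nat.add_sub_cancel_left,
    List.getD_eq_getElem _ _ (by simpa using hi'), List.getElem_map, List.getElem_drop,
    List.getD_eq_getElem β _ hi]
  simp only [Nat.add_comm 1 i]

/-- if `α ∈ S_k` and `β ∈ S_l` both avoid the pattern 132, then the
permutation `α ∨ β ∈ S_{k+l−1}` avoids 132.  (This gives a direct proof that the
Loday–Ronco algebra PBT is stable under the # product.) -/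
theorem vee_avoids_132 (k l : ℕ) (hk : 1 ≤ k) (hl : 1 ≤ l)
    (α β : List ℕ) (hα : IsPermList α) (hαl : α.length = k)
    (hβ : IsPermList β) (hβl : β.length = l)
    (hα132 : Avoids132 α) (hβ132 : Avoids132 β) :
    Avoids132 (vee α β) := by
  subst hαl hβl
  intro i j m hij hjm hm
  rw [vee_length] at hm
  have hlast := hα.one_le_getD (i := α.length - 1) (by omega)
  have hfirst := hβ.one_le_getD (i := 0) (by omega)
  have hfirst' := hβ.getD_le_length (i := 0) (by omega)
  by_cases hmα : m < α.length
  · have h := hα132 i j m hij hjm hmα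
    rw [vee_getD_left α β (by omega : i < α.length), vee_getD_left α β (by omega : j < α.length),
      vee_getD_left α β hmα]
    split_ifs <;> omega
  obtain ⟨m, rfl⟩ := Nat.exists_eq_add_of_le (Nat.le_of_not_lt hmα)
  have hmβ : m + 1 < β.length := by omega
  have hm_le := hβ.getD_le_length hmβ
  rw [vee_getD_right α β hmβ]
  by_cases hjα : j < α.length
  · have hiα : i < α.length := by omega
    have hi_pos := hα.one_le_getD hiα
    have hj_pos := hα.one_le_getD hjα
    have hi_ne : α.getD i 0 ≠ α.getD (α.length - 1) 0 := fun h => by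
      have := hα.getD_inj hiα (by omega) h
      omega
    have h : j < α.length - 1 →
        ¬ (α.getD i 0 < α.getD (α.length - 1) 0 ∧ α.getD (α.length - 1) 0 < α.getD j 0) :=
      fun hj => hα132 i j (α.length - 1) hij hj (by omega)
    have hj_last : ¬ j < α.length - 1 → α.getD j 0 = α.getD (α.length - 1) 0 := fun hj => by
      rw [show j = α.length - 1 by omega]
    rw [vee_getD_left α β hiα, vee_getD_left α β hjα]
    split_ifs <;> omega
  obtain ⟨j, rfl⟩ := Nat.exists_eq_add_of_le (Nat.le_of_not_lt hjα)
  have hjβ : j + 1 < β.length := by omega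
  have hm_ne : β.getD (m + 1) 0 ≠ β.getD 0 0 := fun h => by
    have := hβ.getD_inj hmβ (by omega) h
    omega
  rw [vee_getD_right α β hjβ]
  by_cases hiα : i < α.length
  · have hi_pos := hα.one_le_getD hiα
    have h := hβ132 0 (j + 1) (m + 1) (by omega) (by omega) hmβ
    rw [vee_getD_left α β hiα]
    split_ifs <;> omega
  obtain ⟨i, rfl⟩ := Nat.exists_eq_add_of_le (Nat.le_of_not_lt hiα)
  have h := hβ132 (i + 1) (j + 1) (m + 1) (by omega) (by omega) hmβ
  rw [vee_getD_right α β (by omega : i + 1 < β.length)]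
  split_ifs <;> omega
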